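/- arXiv:2209.05811 — 2 statements merged into one kernel-verified Lean document; each statement's English description precedes it below -/
import Mathlib

section
/- Let X be a median graph, let H = {h, h̄} be a hyperplane of X, and let N(H) be the set of all endpoints of edges dual to H (the vertex set of the carrier of H). Let x_0 x_1 ⋯ x_k be a geodesic in X (a path with k = d(x_0, x_k)) all of whose vertices lie in N(H). Then for every edge {x_i, x_{i+1}} of this path, the hyperplane dual to it is either equal to H or transverse to H (meaning each of its two halfspaces is transverse to h). In particular, if x_0 and x_k lie on the same side of H (both in h, or both in h̄), then every hyperplane dual to an edge of the path is transverse to H. -/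
open scoped BigOperators

namespace MedianQM

variable {V : Type*}

/-- The interval `[x,y]`: vertices on geodesics from `x` to `y`. -/
def interval (X : SimpleGraph V) (x y : V) : Set V :=
  {m | X.dist x m + X.dist m y = X.dist x y}

/-- A median graph: connected, and any three vertices admit a unique median. -/
def IsMedianGraph (X : SimpleGraph V) : Prop :=
  X.Connected ∧ ∀ x y z : V, ∃! m : V,
    m ∈ interval X x y ∧ m ∈ interval X y z ∧ m ∈ interval X x z

/-- A halfspace of `X`: the set of vertices strictly closer to one endpoint of
an edge than to the other. -/
def IsHalfspace (X : SimpleGraph V) (h : Set V) : Prop :=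
  ∃ a b : V, X.Adj a b ∧ h = {v | X.dist v a < X.dist v b}

/-- The edge `{a,b}` is dual to the halfspace `h` (equivalently, to the
hyperplane `{h, h̄}`). -/
def EdgeDual (X : SimpleGraph V) (h : Set V) (a b : V) : Prop :=
  X.Adj a b ∧
    (h = {v | X.dist v a < X.dist v b} ∨ h = {v | X.dist v b < X.dist v a})

/-- Two halfspaces are transverse. -/
def Transv (h k : Set V) : Prop :=
  (h ∩ k).Nonempty ∧ (hᶜ ∩ k).Nonempty ∧ (h ∩ kᶜ).Nonempty ∧ (hᶜ ∩ kᶜ).Nonempty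

/-- `[x,y]_H`: the set of halfspaces separating `y` from `x`. -/
def sepH (X : SimpleGraph V) (x y : V) : Set (Set V) :=
  {h | IsHalfspace X h ∧ y ∈ h ∧ x ∉ h}

/-- `X` has dimension at most `D`: every (finite) family of pairwise transverse
halfspaces has at most `D` elements. -/
def DimLE (X : SimpleGraph V) (D : ℕ) : Prop :=
  ∀ S : Finset (Set V), (∀ h ∈ S, IsHalfspace X h) →
    (∀ h ∈ S, ∀ k ∈ S, h ≠ k → Transv h k) → S.card ≤ D

/-- `h ⊋ k` are tightly nested: no halfspace lies strictly between them. -/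
def TightlyNested (X : SimpleGraph V) (h k : Set V) : Prop :=
  k ⊂ h ∧ ¬ ∃ h' : Set V, IsHalfspace X h' ∧ h' ⊂ h ∧ k ⊂ h'

/-- A staircase of length `n`. -/
def IsStaircase (X : SimpleGraph V) (n : ℕ) (h k : Fin n → Set V) : Prop :=
  (∀ i, IsHalfspace X (h i)) ∧ (∀ i, IsHalfspace X (k i)) ∧
  (∀ i j : Fin n, i < j → h j ⊂ h i) ∧ (∀ i j : Fin n, i < j → k j ⊂ k i) ∧
  (∀ i, k i ⊂ h i) ∧ (∀ i j : Fin n, j < i → Transv (h i) (k j))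

/-- `X` has staircase length at most `σ`: there is no staircase of length `σ+1`. -/
def StaircaseLE (X : SimpleGraph V) (σ : ℕ) : Prop :=
  ∀ h k : Fin (σ + 1) → Set V, ¬ IsStaircase X (σ + 1) h k

/-- An `H`-segment of length `l`: a tuple of consecutively tightly nested
halfspaces `h₁ ⊋ ⋯ ⊋ h_l`. -/
def IsHSegment (X : SimpleGraph V) (l : ℕ) (s : Fin l → Set V) : Prop :=
  (∀ i, IsHalfspace X (s i)) ∧
  ∀ i j : Fin l, (j : ℕ) = (i : ℕ) + 1 → TightlyNested X (s i) (s j)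

/-- The segment `t` is contained in `[x,y]_H`. -/
def SegIn (X : SimpleGraph V) (x y : V) {l : ℕ} (t : Fin l → Set V) : Prop :=
  ∀ i, t i ∈ sepH X x y

/-- The translate of a segment by a group element. -/
def segSMul {Γ : Type*} [SMul Γ V] (γ : Γ) {l : ℕ} (s : Fin l → Set V) :
    Fin l → Set V :=
  fun i => (γ • ·) '' s i

/-- The set of translates of `s` contained in `[x,y]_H`. -/
def translatesIn (X : SimpleGraph V) (Γ : Type*) [SMul Γ V] {l : ℕ}
    (s : Fin l → Set V) (x y : V) : Set (Fin l → Set V) :=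
  {t | (∃ γ : Γ, t = segSMul γ s) ∧ SegIn X x y t}

/-- The median quasimorphism of the segment `s` (for the action of `Γ` on `X`). -/
noncomputable def fs (X : SimpleGraph V) (Γ : Type*) [SMul Γ V] {l : ℕ}
    (s : Fin l → Set V) (x y : V) : ℝ :=
  ((translatesIn X Γ s x y).ncard : ℝ) - ((translatesIn X Γ s y x).ncard : ℝ)

/-- The coboundary of a function of two variables, evaluated on a triple. -/
noncomputable def d1 (f : V → V → ℝ) (x y z : V) : ℝ := f y z - f x z + f x y

/-- The simplicial coboundary operator. -/
noncomputable def cob {W : Type*} {m : ℕ} (β : (Fin (m + 1) → W) → ℝ) :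
    (Fin (m + 2) → W) → ℝ :=
  fun x => ∑ j : Fin (m + 2), (-1 : ℝ) ^ (j : ℕ) * β (fun i => x (j.succAbove i))

/-- Γ-invariance of a cochain. -/
def IsInvariant (Γ : Type*) {W : Type*} [SMul Γ W] {m : ℕ}
    (β : (Fin m → W) → ℝ) : Prop :=
  ∀ (γ : Γ) (x : Fin m → W), β (fun i => γ • x i) = β x

/-- Boundedness of a real-valued function. -/
def IsBounded {α : Type*} (β : α → ℝ) : Prop := ∃ C : ℝ, ∀ x, |β x| ≤ C

/-- A head of the segment `s`. -/
def IsHead (X : SimpleGraph V) {l : ℕ} (hl : 0 < l) (s : Fin l → Set V)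
    (a : V) : Prop :=
  a ∉ s ⟨0, hl⟩ ∧ ∃ b, EdgeDual X (s ⟨0, hl⟩) a b

/-- A tail of the segment `s`. -/
def IsTail (X : SimpleGraph V) {l : ℕ} (hl : 0 < l) (s : Fin l → Set V)
    (a : V) : Prop :=
  a ∈ s ⟨l - 1, by omega⟩ ∧ ∃ b, EdgeDual X (s ⟨l - 1, by omega⟩) a b

/-- The cochain `κ` is non-transverse to the segment `s`. -/
def NonTransverseTo (X : SimpleGraph V) {n l : ℕ} (hl : 0 < l)
    (κ : (Fin (n + 1) → V) → ℝ) (s : Fin l → Set V) : Prop :=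
  (∀ (x : Fin n → V) (a a' : V), IsHead X hl s a → IsHead X hl s a' →
    κ (Fin.cons a x) = κ (Fin.cons a' x)) ∧
  (∀ (x : Fin n → V) (a a' : V), IsTail X hl s a → IsTail X hl s a' →
    κ (Fin.cons a x) = κ (Fin.cons a' x))

/-- The action of `Γ` on `X` is by graph automorphisms. -/
def ActsOn (Γ : Type*) [SMul Γ V] (X : SimpleGraph V) : Prop :=
  ∀ (γ : Γ) (a b : V), X.Adj a b → X.Adj (γ • a) (γ • b)


theorem IsMedianGraph.dist_ne_of_adj {V : Type*} {X : SimpleGraph V} (hmed : IsMedianGraph X)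
    {a b : V} (hab : X.Adj a b) (v : V) : X.dist v a ≠ X.dist v b := by
  obtain ⟨m, ⟨hva, hm, hvb⟩, -⟩ := hmed.2 v a b
  simp only [interval, Set.mem_ofPred_eq] at hva hm hvb
  have h1 : X.dist a b = 1 := SimpleGraph.dist_eq_one_iff_adj.mpr hab
  have h2 : X.dist m a = X.dist a m := SimpleGraph.dist_comm
  omega

theorem EdgeDual.symm {V : Type*} {X : SimpleGraph V} {h : Set V} {a b : V}
    (hab : EdgeDual X h a b) : EdgeDual X h b a :=
  ⟨hab.1.symm, hab.2.symm⟩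

theorem EdgeDual.mem_iff_notMem {V : Type*} {X : SimpleGraph V} {h : Set V} {a b : V}
    (hab : EdgeDual X h a b) : a ∈ h ↔ b ∉ h := by
  obtain ⟨hadj, rfl | rfl⟩ := hab <;>
    simp [SimpleGraph.dist_eq_one_iff_adj.mpr hadj, SimpleGraph.dist_eq_one_iff_adj.mpr hadj.symm]

/-- The only neighbour of `p` across a hyperplane dual to the edge `{p, u}` is `u`. -/
theorem EdgeDual.eq_of_adj_of_not_mem_iff {V : Type*} {X : SimpleGraph V}
    (hmed : IsMedianGraph X) {h : Set V} {p q u : V} (hpu : EdgeDual X h p u)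
    (hpq : X.Adj p q) (hside : ¬ (p ∈ h ↔ q ∈ h)) : q = u := by
  have hp := hpu.mem_iff_notMem
  have hqp : X.dist q p = 1 := SimpleGraph.dist_eq_one_iff_adj.mpr hpq.symm
  have hup : X.dist u p = 1 := SimpleGraph.dist_eq_one_iff_adj.mpr hpu.1.symm
  have hne := hmed.dist_ne_of_adj hpu.1 q
  rw [← hmed.1.dist_eq_zero_iff]
  obtain ⟨hadj, rfl | rfl⟩ := hpu <;>
    simp only [Set.mem_ofPred_eq, SimpleGraph.dist_self] at hp hside <;> omega

theorem EdgeDual.eq_or_eq_compl {V : Type*} {X : SimpleGraph V} (hmed : IsMedianGraph X)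
    {g h : Set V} {a b : V} (hg : EdgeDual X g a b) (hh : EdgeDual X h a b) :
    g = h ∨ g = hᶜ := by
  have hcompl : {v | X.dist v a < X.dist v b}ᶜ = {v | X.dist v b < X.dist v a} := by
    ext v
    have := hmed.dist_ne_of_adj hg.1 v
    simp only [Set.mem_compl_iff, Set.mem_ofPred_eq]
    omega
  obtain ⟨-, rfl | rfl⟩ := hg <;> obtain ⟨-, rfl | rfl⟩ := hh <;> simp [← hcompl]

/-- An edge of the carrier of `h` which does not cross `h` is dual to a halfspace transverse
to `h`. -/
theorem EdgeDual.transv_of_mem_iff {V : Type*} {X : SimpleGraph V} (hmed : IsMedianGraph X)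
    {g h : Set V} {p q u w : V} (hg : EdgeDual X g p q) (hpu : EdgeDual X h p u)
    (hqw : EdgeDual X h q w) (hside : p ∈ h ↔ q ∈ h) : Transv g h := by
  have hp := hpu.mem_iff_notMem
  have hq := hqw.mem_iff_notMem
  have hpq := hg.mem_iff_notMem
  have hu : p ∈ g ↔ u ∈ g := by
    by_contra hcon
    have := hg.eq_of_adj_of_not_mem_iff hmed hpu.1 hcon
    subst this
    grind
  have hw : q ∈ g ↔ w ∈ g := by
    by_contra hcon
    have := hg.symm.eq_of_adj_of_not_mem_iff hmed hqw.1 hcon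
    subst this
    grind
  have key : ∀ a b : Prop, ∃ v, (v ∈ g ↔ a) ∧ (v ∈ h ↔ b) := by
    intro a b
    by_cases hpa : p ∈ g ↔ a <;> by_cases hpb : p ∈ h ↔ b
    · exact ⟨p, hpa, hpb⟩
    · exact ⟨u, by grind, by grind⟩
    · exact ⟨q, by grind, by grind⟩
    · exact ⟨w, by grind, by grind⟩
  refine ⟨?_, ?_, ?_, ?_⟩
  · obtain ⟨v, h1, h2⟩ := key True True
    exact ⟨v, h1.2 trivial, h2.2 trivial⟩
  · obtain ⟨v, h1, h2⟩ := key False True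
    exact ⟨v, h1.1, h2.2 trivial⟩
  · obtain ⟨v, h1, h2⟩ := key True False
    exact ⟨v, h1.2 trivial, h2.1⟩
  · obtain ⟨v, h1, h2⟩ := key False False
    exact ⟨v, h1.1, h2.1⟩

theorem dist_zero_and_dist_last_of_geodesic {V : Type*} {X : SimpleGraph V} (hconn : X.Connected)
    {k : ℕ} {x : Fin (k + 1) → V} (hadj : ∀ i : Fin k, X.Adj (x i.castSucc) (x i.succ))
    (hgeo : X.dist (x 0) (x (Fin.last k)) = k) (i : Fin (k + 1)) :
    X.dist (x 0) (x i) = i ∧ X.dist (x (Fin.last k)) (x i) + i = k := by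
  have h0 : X.dist (x 0) (x i) ≤ i := by
    induction i using Fin.induction with
    | zero => simp
    | succ i ih =>
      have h1 := SimpleGraph.dist_eq_one_iff_adj.mpr (hadj i)
      have h2 := hconn.dist_triangle (u := x 0) (v := x i.castSucc) (w := x i.succ)
      simp only [Fin.val_castSucc, Fin.val_succ] at ih ⊢
      omega
  have hl : X.dist (x (Fin.last k)) (x i) + i ≤ k := by
    clear h0
    induction i using Fin.reverseInduction with
    | last => simp
    | cast i ih =>
      have h1 := SimpleGraph.dist_eq_one_iff_adj.mpr (hadj i).symm
      have h2 := hconn.dist_triangle (u := x (Fin.last k)) (v := x i.succ) (w := x i.castSucc)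
      simp only [Fin.val_castSucc, Fin.val_succ] at ih ⊢
      omega
  have htri := hconn.dist_triangle (u := x 0) (v := x i) (w := x (Fin.last k))
  rw [SimpleGraph.dist_comm (u := x i)] at htri
  omega

/-- Lemma `lem:carrier`: in a median graph, let `H = {h, h̄}` be a
hyperplane and let `x₀ x₁ ⋯ x_k` be a geodesic all of whose vertices are endpoints of
edges dual to `H` (i.e. lie in the carrier `N(H)`). Then every hyperplane dual to an
edge of the geodesic is either equal to `H` or transverse to `H`; and if moreover the
endpoints `x₀`, `x_k` lie on the same side of `H`, then every hyperplane dual to an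
edge of the geodesic is transverse to `H`. -/
theorem statement9 {V : Type*} (X : SimpleGraph V) (hmed : IsMedianGraph X)
    (h : Set V) (hh : IsHalfspace X h)
    (k : ℕ) (x : Fin (k + 1) → V)
    (hadj : ∀ i : Fin k, X.Adj (x i.castSucc) (x i.succ))
    (hgeo : X.dist (x 0) (x (Fin.last k)) = k)
    (hcarrier : ∀ i : Fin (k + 1), ∃ u : V, EdgeDual X h (x i) u) :
    (∀ i : Fin k, ∀ g : Set V, EdgeDual X g (x i.castSucc) (x i.succ) →
      (g = h ∨ g = hᶜ ∨ Transv g h)) ∧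
    ((x 0 ∈ h ↔ x (Fin.last k) ∈ h) →
      ∀ i : Fin k, ∀ g : Set V, EdgeDual X g (x i.castSucc) (x i.succ) →
        Transv g h) := by
  have cross : ∀ i : Fin k, ¬ (x i.castSucc ∈ h ↔ x i.succ ∈ h) →
      EdgeDual X h (x i.castSucc) (x i.succ) := by
    intro i hi
    obtain ⟨u, hu⟩ := hcarrier i.castSucc
    rwa [hu.eq_of_adj_of_not_mem_iff hmed (hadj i) hi]
  have transv : ∀ i : Fin k, (x i.castSucc ∈ h ↔ x i.succ ∈ h) →
      ∀ g : Set V, EdgeDual X g (x i.castSucc) (x i.succ) → Transv g h := by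
    intro i hi g hg
    obtain ⟨u, hu⟩ := hcarrier i.castSucc
    obtain ⟨w, hw⟩ := hcarrier i.succ
    exact hg.transv_of_mem_iff hmed hu hw hi
  refine ⟨fun i g hg => ?_, fun hends i => transv i ?_⟩
  · by_cases hi : x i.castSucc ∈ h ↔ x i.succ ∈ h
    · exact Or.inr (Or.inr (transv i hi g hg))
    · rcases hg.eq_or_eq_compl hmed (cross i hi) with hgh | hgh
      · exact Or.inl hgh
      · exact Or.inr (Or.inl hgh)
  · by_contra hi
    have hdual := (cross i hi).2
    have hcast := dist_zero_and_dist_last_of_geodesic hmed.1 hadj hgeo i.castSucc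
    have hsucc := dist_zero_and_dist_last_of_geodesic hmed.1 hadj hgeo i.succ
    simp only [Fin.val_castSucc, Fin.val_succ] at hcast hsucc
    rcases hdual with hdual | hdual <;> rw [hdual] at hends <;>
      simp only [Set.mem_ofPred_eq] at hends <;> omega

end MedianQM
end

section
/- Let F be the free group on a set S with at least two elements (a non-abelian free group), and let w, w' ∈ F. Then the big Brooks quasimorphisms H_w and H_{w'} are at bounded distance if and only if w = w'. -/
open scoped BigOperators

namespace MedianQM

variable {V : Type*}

/-- The number of (possibly overlapping) occurrences of the reduced word of `w` as a
contiguous subword of the reduced word of `γ` in a free group. -/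
def countOcc {α : Type*} [DecidableEq α] (w γ : FreeGroup α) : ℕ :=
  ((List.range (γ.toWord.length + 1)).filter
    (fun i => w.toWord.isPrefixOf (γ.toWord.drop i))).length

/-- The big Brooks quasimorphism `H_w(γ) = C_w(γ) − C_{w⁻¹}(γ)`. -/
noncomputable def Brooks {α : Type*} [DecidableEq α] (w γ : FreeGroup α) : ℝ :=
  (countOcc w γ : ℝ) - (countOcc w⁻¹ γ : ℝ)

section SuffixSum

variable {A : Type*}

/-- The sum of a function over all suffixes of a list. -/
def suffixSum (φ : List A → ℝ) (L : List A) : ℝ := (L.tails.map φ).sum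

/-- `φ L` depends only on the first `n` letters of `L`. -/
def IsLocal (n : ℕ) (φ : List A → ℝ) : Prop :=
  ∀ L L' : List A, L.take n = L'.take n → φ L = φ L'

lemma suffixSum_cons (φ : List A → ℝ) (a : A) (L : List A) :
    suffixSum φ (a :: L) = φ (a :: L) + suffixSum φ L := by
  simp [suffixSum]

lemma take_append_congr {k : ℕ} {R R' : List A} (P : List A) (h : R.take k = R'.take k) :
    (P ++ R).take k = (P ++ R').take k := by
  have h' := congrArg (List.take (k - P.length)) h
  rw [List.take_take, List.take_take, Nat.min_eq_left (Nat.sub_le _ _)] at h'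
  rw [List.take_append, List.take_append, h']

lemma IsLocal.suffixSum_append_sub {φ : List A → ℝ} {k : ℕ} (hφ : IsLocal (k + 1) φ)
    (P : List A) {R R' : List A} (h : R.take k = R'.take k) :
    suffixSum φ (P ++ R) - suffixSum φ R = suffixSum φ (P ++ R') - suffixSum φ R' := by
  induction P with
  | nil => simp
  | cons a P ih =>
    have hloc : φ (a :: (P ++ R)) = φ (a :: (P ++ R')) := by
      apply hφ
      rw [List.take_succ_cons, List.take_succ_cons, take_append_congr P h]
    rw [List.cons_append, List.cons_append, suffixSum_cons, suffixSum_cons, hloc]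
    linarith

lemma eq_zero_of_forall_abs_nat_mul_add_le {c d C : ℝ} (h : ∀ j : ℕ, |j * c + d| ≤ C) :
    c = 0 := by
  by_contra hc
  obtain ⟨j, hj⟩ := exists_nat_gt ((C + |d|) / |c|)
  rw [div_lt_iff₀ (abs_pos.mpr hc)] at hj
  have h₁ : |(j : ℝ) * c| ≤ |j * c + d| + |d| := by
    simpa using abs_sub (j * c + d) d
  rw [abs_mul, Nat.abs_cast] at h₁
  linarith [h j]

/-- If a local function has bounded suffix sums along a periodic family of words, then its sum
over one period vanishes. -/
lemma IsLocal.suffixSum_period {φ : List A → ℝ} {k : ℕ} (hφ : IsLocal (k + 1) φ)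
    {P X : List A} (hX : (P ++ X).take k = X.take k) {C : ℝ}
    (hC : ∀ j : ℕ, |suffixSum φ ((P ++ ·)^[j] X)| ≤ C) :
    suffixSum φ (P ++ X) = suffixSum φ X := by
  have htake : ∀ j : ℕ, ((P ++ ·)^[j] X).take k = X.take k := by
    intro j
    induction j with
    | zero => rfl
    | succ j ih =>
      rw [Function.iterate_succ_apply', take_append_congr P ih, hX]
  have hsum : ∀ j : ℕ, suffixSum φ ((P ++ ·)^[j] X) =
      j * (suffixSum φ (P ++ X) - suffixSum φ X) + suffixSum φ X := by
    intro j
    induction j with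
    | zero => simp
    | succ j ih =>
      rw [Function.iterate_succ_apply']
      have := hφ.suffixSum_append_sub P (htake j)
      push_cast
      linarith
  have := eq_zero_of_forall_abs_nat_mul_add_le fun j => hsum j ▸ hC j
  linarith

lemma length_filter_range_drop (p : List A → Bool) (L : List A) :
    ((((List.range (L.length + 1)).filter (fun i => p (L.drop i))).length : ℕ) : ℝ) =
      suffixSum (fun M => if p M then 1 else 0) L := by
  induction L with
  | nil => by_cases h : p [] <;> simp [suffixSum, List.range_succ, h]
  | cons a L ih =>
    rw [suffixSum_cons, ← ih, List.length_cons, List.range_succ_eq_map, List.filter_cons,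
      List.filter_map, List.drop_zero]
    by_cases h : p (a :: L) <;> simp [h, Function.comp_def, add_comm]

lemma suffixSum_sub (φ ψ : List A → ℝ) (L : List A) :
    suffixSum (fun M => φ M - ψ M) L = suffixSum φ L - suffixSum ψ L := by
  induction L with
  | nil => simp [suffixSum]
  | cons a L ih => rw [suffixSum_cons, suffixSum_cons, suffixSum_cons, ih]; ring

end SuffixSum

section Letters

variable {S : Type*}

/-- The inverse of a letter. -/
def letterInv (a : S × Bool) : S × Bool := (a.1, !a.2)

@[simp] lemma letterInv_letterInv (a : S × Bool) : letterInv (letterInv a) = a := by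
  simp [letterInv]

lemma letterInv_eq_comm {a b : S × Bool} : letterInv a = b ↔ a = letterInv b :=
  ⟨fun h => by simp [← h], fun h => by simp [h]⟩

lemma not_cancel_iff {a b : S × Bool} : (a.1 = b.1 → a.2 = b.2) ↔ b ≠ letterInv a := by
  rcases a with ⟨a, _ | _⟩ <;> rcases b with ⟨b, _ | _⟩ <;>
    simp [letterInv, eq_comm]

lemma exists_letter_ne (hS : ∃ a b : S, a ≠ b) (x y z : S × Bool) :
    ∃ v : S × Bool, v ≠ x ∧ v ≠ y ∧ v ≠ z := by
  obtain ⟨a, b, hab⟩ := hS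
  classical
  have hcard : ({x, y, z} : Finset (S × Bool)).card <
      ({(a, true), (a, false), (b, true), (b, false)} : Finset (S × Bool)).card :=
    Finset.card_le_three.trans_lt (by simp [hab])
  obtain ⟨v, -, hv⟩ := Finset.exists_mem_notMem_of_card_lt_card hcard
  exact ⟨v, by simpa using hv⟩

lemma isReduced_cons_append_singleton {m : List (S × Bool)} {x y : S × Bool}
    (hm : FreeGroup.IsReduced m) (hx : ∀ a ∈ m.head?, x ≠ letterInv a)
    (hy : ∀ a ∈ m.getLast?, y ≠ letterInv a) (hne : m ≠ []) :
    FreeGroup.IsReduced (x :: (m ++ [y])) := by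
  unfold FreeGroup.IsReduced at hm ⊢
  rw [List.isChain_cons, List.isChain_append]
  refine ⟨fun a ha => ?_, hm, List.isChain_singleton _, fun a ha b hb => ?_⟩
  · rw [not_cancel_iff]
    rw [List.head?_append_of_ne_nil _ hne] at ha
    exact fun h => hx a ha (letterInv_eq_comm.mp h.symm)
  · have hb' : y = b := by simpa using hb
    rw [not_cancel_iff, ← hb']
    exact hy a ha

lemma invRev_cons_append_singleton (m : List (S × Bool)) (x y : S × Bool) :
    FreeGroup.invRev (x :: (m ++ [y])) =
      letterInv y :: (FreeGroup.invRev m ++ [letterInv x]) := by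
  simp [FreeGroup.invRev, letterInv]

/-- The mixed second difference, in the first and the last letter of a window, of a local function
whose suffix sums are bounded on reduced words vanishes. -/
lemma IsLocal.mixed_difference_eq_zero (hS : ∃ a b : S, a ≠ b) {φ : List (S × Bool) → ℝ}
    {m : List (S × Bool)} (hφ : IsLocal (m.length + 2) φ) {C : ℝ}
    (hC : ∀ L, FreeGroup.IsReduced L → |suffixSum φ L| ≤ C) {t t' s s' : S × Bool}
    (h₁ : FreeGroup.IsReduced (t :: (m ++ [s]))) (h₂ : FreeGroup.IsReduced (t :: (m ++ [s'])))
    (h₃ : FreeGroup.IsReduced (t' :: (m ++ [s]))) (h₄ : FreeGroup.IsReduced (t' :: (m ++ [s']))) :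
    φ (t :: (m ++ [s])) + φ (t' :: (m ++ [s'])) =
      φ (t :: (m ++ [s'])) + φ (t' :: (m ++ [s])) := by
  obtain ⟨z, hzt, hzt', -⟩ := exists_letter_ne hS (letterInv t) (letterInv t') (letterInv t')
  obtain ⟨y, hys, hys', hyz⟩ := exists_letter_ne hS (letterInv s) (letterInv s') (letterInv z)
  set X : List (S × Bool) := List.replicate (m.length + 2) z with hX
  have hXcons : X = z :: List.replicate (m.length + 1) z := List.replicate_succ
  have key : ∀ p q : S × Bool, z ≠ letterInv p → y ≠ letterInv q →
      FreeGroup.IsReduced (p :: (m ++ [q])) →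
      φ (p :: (m ++ [q])) = -(suffixSum φ (X ++ p :: m) - suffixSum φ (p :: m)) -
        (suffixSum φ (m ++ q :: y :: X) - suffixSum φ X) := by
    intro p q hzp hyq hred
    have hP : FreeGroup.IsReduced (X ++ p :: (m ++ [q]) ++ [y]) := by
      unfold FreeGroup.IsReduced at hred ⊢
      rw [List.isChain_append, List.isChain_append]
      refine ⟨⟨List.isChain_replicate_of_rel _ fun _ => rfl, hred, ?_⟩,
        List.isChain_singleton _, ?_⟩
      · intro a ha b hb
        have ha' : a = z := List.eq_of_mem_replicate (List.mem_of_mem_getLast? ha)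
        have hb' : p = b := by simpa using hb
        subst ha' hb'
        rw [not_cancel_iff]
        exact fun h => hzp (letterInv_eq_comm.mp h.symm)
      · intro a ha b hb
        have ha' : q = a := by simpa [List.getLast?_append, List.getLast?_cons] using ha
        have hb' : y = b := by simpa using hb
        subst ha' hb'
        rw [not_cancel_iff]
        exact hyq
    set P := X ++ p :: (m ++ [q]) ++ [y] with hPdef
    have hred_iter : ∀ j : ℕ, FreeGroup.IsReduced ((P ++ ·)^[j] X) ∧
        ((P ++ ·)^[j] X).head? = some z := by
      intro j
      induction j with
      | zero =>
        refine ⟨List.isChain_replicate_of_rel _ fun _ => rfl, ?_⟩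
        simp [hXcons]
      | succ j ih =>
        rw [Function.iterate_succ_apply']
        refine ⟨?_, by simp [hPdef, hXcons]⟩
        unfold FreeGroup.IsReduced
        rw [List.isChain_append]
        refine ⟨hP, ih.1, fun a ha b hb => ?_⟩
        have ha' : y = a := by simpa [hPdef, List.getLast?_cons] using ha
        have hb' : z = b := by simpa [ih.2] using hb
        subst ha' hb'
        rw [not_cancel_iff]
        exact fun h => hyz (letterInv_eq_comm.mp h.symm)
    have hper := hφ.suffixSum_period (P := P) (X := X)
      (by simp [hPdef, hX, List.take_append]) (fun j => hC _ (hred_iter j).1)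
    have e₁ : P ++ X = X ++ (p :: (m ++ q :: y :: X)) := by simp [hPdef]
    have e₂ := hφ.suffixSum_append_sub X (R := p :: (m ++ q :: y :: X)) (R' := p :: m) (by simp)
    have e₃ : φ (p :: (m ++ q :: y :: X)) = φ (p :: (m ++ [q])) := by
      apply hφ
      simp [List.take_append]
    rw [e₁] at hper
    rw [suffixSum_cons, e₃] at e₂
    linarith
  rw [key t s hzt hys h₁, key t s' hzt hys' h₂, key t' s hzt' hys h₃, key t' s' hzt' hys' h₄]
  ring

end Letters

section Windows

variable {S : Type*} [DecidableEq S]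

/-- The contribution to `Brooks u` of the occurrences starting at the beginning of `L`. -/
def brooksWindow (u : FreeGroup S) (L : List (S × Bool)) : ℝ :=
  (if u.toWord.isPrefixOf L then 1 else 0) - (if u⁻¹.toWord.isPrefixOf L then 1 else 0)

lemma brooks_eq_suffixSum (u γ : FreeGroup S) :
    Brooks u γ = suffixSum (brooksWindow u) γ.toWord := by
  unfold Brooks countOcc
  rw [length_filter_range_drop (fun M => u.toWord.isPrefixOf M),
    length_filter_range_drop (fun M => u⁻¹.toWord.isPrefixOf M), ← suffixSum_sub]
  rfl

lemma isPrefixOf_congr {n : ℕ} {u L L' : List (S × Bool)} (hu : u.length ≤ n)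
    (h : L.take n = L'.take n) : u.isPrefixOf L = u.isPrefixOf L' := by
  rw [Bool.eq_iff_iff, List.isPrefixOf_iff_prefix, List.isPrefixOf_iff_prefix,
    List.prefix_iff_eq_take, List.prefix_iff_eq_take, ← Nat.min_eq_left hu,
    ← List.take_take, ← List.take_take, h]

lemma length_toWord_inv (u : FreeGroup S) : u⁻¹.toWord.length = u.toWord.length := by
  rw [FreeGroup.toWord_inv, FreeGroup.invRev_length]

lemma isLocal_brooksWindow {n : ℕ} {u : FreeGroup S} (hu : u.toWord.length ≤ n) :
    IsLocal n (brooksWindow u) := by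
  intro L L' h
  unfold brooksWindow
  rw [isPrefixOf_congr hu h, isPrefixOf_congr ((length_toWord_inv u).trans_le hu) h]

lemma isPrefixOf_of_length_eq {u L : List (S × Bool)} (h : u.length = L.length) :
    u.isPrefixOf L = decide (u = L) := by
  rw [Bool.eq_iff_iff, List.isPrefixOf_iff_prefix, decide_eq_true_iff]
  exact ⟨fun hp => hp.eq_of_length h, fun he => he ▸ List.prefix_rfl⟩

lemma brooksWindow_of_length_eq {u : FreeGroup S} {L : List (S × Bool)}
    (h : u.toWord.length = L.length) :
    brooksWindow u L = (if u.toWord = L then 1 else 0) - (if u⁻¹.toWord = L then 1 else 0) := by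
  unfold brooksWindow
  rw [isPrefixOf_of_length_eq h, isPrefixOf_of_length_eq ((length_toWord_inv u).trans h)]
  simp

lemma invRev_ne_self {L : List (S × Bool)} (hL : FreeGroup.IsReduced L) (h : L ≠ []) :
    FreeGroup.invRev L ≠ L := by
  intro he
  have h₁ : (FreeGroup.mk L)⁻¹ = FreeGroup.mk L := by rw [FreeGroup.inv_mk, he]
  have h₂ : FreeGroup.mk L = 1 := by
    rw [inv_eq_iff_mul_eq_one, ← pow_two] at h₁
    exact (pow_eq_one_iff_left two_ne_zero).mp h₁
  apply h
  rw [← hL.reduce_eq, ← FreeGroup.toWord_mk, h₂, FreeGroup.toWord_one]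

/-- At most one of the words `x m y` is equal to `u` or `u⁻¹` when `m` is nonempty. -/
lemma exists_unique_ends {m : List (S × Bool)} (hm : FreeGroup.IsReduced m) (hne : m ≠ [])
    (hS : Nonempty S) (u : FreeGroup S) :
    ∃ a b : S × Bool, ∀ x y, (u.toWord = x :: (m ++ [y]) ∨ u⁻¹.toWord = x :: (m ++ [y])) →
      x = a ∧ y = b := by
  obtain ⟨o⟩ := hS
  by_cases h : ∃ a b : S × Bool, u.toWord = a :: (m ++ [b]) ∨ u⁻¹.toWord = a :: (m ++ [b])
  · obtain ⟨a, b, hab⟩ := h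
    have hinv := invRev_ne_self hm hne
    refine ⟨a, b, fun x y hxy => ?_⟩
    rw [FreeGroup.toWord_inv] at hab hxy
    rcases hab with hab | hab <;> rcases hxy with hxy | hxy
    · simpa using hxy.symm.trans hab
    · rw [hab, invRev_cons_append_singleton] at hxy
      simp_all
    · rw [hxy, invRev_cons_append_singleton] at hab
      simp_all
    · simpa using hxy.symm.trans hab
  · push Not at h
    exact ⟨(o, true), (o, true), fun x y hxy => absurd hxy (by simpa using h x y)⟩

lemma toWord_ne_toWord_inv {u : FreeGroup S} (hu : u.toWord ≠ []) : u.toWord ≠ u⁻¹.toWord := by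
  rw [FreeGroup.toWord_inv]
  exact (invRev_ne_self FreeGroup.isReduced_toWord hu).symm

/-- Bounded distance of `H_w` and `H_{w'}`, phrased on reduced words. -/
lemma abs_suffixSum_le {w w' : FreeGroup S} {C : ℝ}
    (hC : ∀ γ : FreeGroup S, |Brooks w γ - Brooks w' γ| ≤ C) (L : List (S × Bool))
    (hL : FreeGroup.IsReduced L) :
    |suffixSum (fun M => brooksWindow w M - brooksWindow w' M) L| ≤ C := by
  have h := hC (FreeGroup.mk L)
  rwa [brooks_eq_suffixSum, brooks_eq_suffixSum, FreeGroup.toWord_mk, hL.reduce_eq,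
    ← suffixSum_sub] at h

lemma isLocal_brooksWindow_sub {n : ℕ} {w w' : FreeGroup S} (hw : w.toWord.length ≤ n)
    (hw' : w'.toWord.length ≤ n) :
    IsLocal n (fun M => brooksWindow w M - brooksWindow w' M) := fun L L' h => by
  simp only [isLocal_brooksWindow hw L L' h, isLocal_brooksWindow hw' L L' h]

/-- The windows of a word shorter than the window length do not see the last letter. -/
lemma brooksWindow_of_length_lt {w : FreeGroup S} {x : S × Bool} {m : List (S × Bool)}
    (h : w.toWord.length < m.length + 2) (y y' : S × Bool) :
    brooksWindow w (x :: (m ++ [y])) = brooksWindow w (x :: (m ++ [y'])) :=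
  isLocal_brooksWindow (Nat.le_of_lt_succ h) _ _ (by simp)

lemma unbounded_of_length_one {w w' : FreeGroup S} {s : S × Bool} (hw' : w'.toWord = [s])
    (hw : w.toWord.length ≤ 1) (hne : w ≠ w') {C : ℝ} :
    ¬ ∀ γ : FreeGroup S, |Brooks w γ - Brooks w' γ| ≤ C := by
  intro hC
  have hloc : IsLocal (0 + 1) (fun M => brooksWindow w M - brooksWindow w' M) :=
    isLocal_brooksWindow_sub hw (by simp [hw'])
  have hiter : ∀ j : ℕ, ([s] ++ ·)^[j] [] = List.replicate j s := by
    intro j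
    induction j with
    | zero => rfl
    | succ j ih => rw [Function.iterate_succ_apply', ih]; rfl
  have hper := hloc.suffixSum_period (P := [s]) (X := []) rfl (C := C) fun j => by
    rw [hiter]
    exact abs_suffixSum_le hC _ (List.isChain_replicate_of_rel _ fun _ => rfl)
  rw [List.append_nil, suffixSum_cons, add_eq_right] at hper
  have hws : w.toWord ≠ [s] := fun h => hne (FreeGroup.toWord_injective (h.trans hw'.symm))
  have hw's : w'⁻¹.toWord ≠ [s] := hw' ▸ (toWord_ne_toWord_inv (by simp [hw'])).symm
  rw [brooksWindow_of_length_eq (u := w') (by simp [hw']), if_pos hw', if_neg hw's] at hper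
  rcases hw.lt_or_eq with h | h
  · have : w = 1 := FreeGroup.toWord_eq_nil_iff.mp (List.length_eq_zero_iff.mp (by omega))
    subst this
    simp [brooksWindow] at hper
  · rw [brooksWindow_of_length_eq (by simp [h]), if_neg hws] at hper
    split_ifs at hper <;> norm_num at hper

lemma unbounded_of_length_two (hS : ∃ a b : S, a ≠ b) {w w' : FreeGroup S} {t s : S × Bool}
    (hw' : w'.toWord = [t, s]) (hw : w.toWord.length ≤ 2) (hne : w ≠ w') {C : ℝ} :
    ¬ ∀ γ : FreeGroup S, |Brooks w γ - Brooks w' γ| ≤ C := by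
  intro hC
  have hloc : IsLocal (([] : List (S × Bool)).length + 2)
      (fun M => brooksWindow w M - brooksWindow w' M) :=
    isLocal_brooksWindow_sub hw (by simp [hw'])
  have hred : ∀ x y : S × Bool, x ≠ y → FreeGroup.IsReduced (x :: ([] ++ [letterInv y])) := by
    intro x y h
    simp only [FreeGroup.IsReduced, List.nil_append, List.isChain_pair, not_cancel_iff]
    exact fun he => h (by simpa using congrArg letterInv he.symm)
  obtain ⟨q, rfl⟩ : ∃ q, s = letterInv q := ⟨letterInv s, by simp⟩
  have htq : t ≠ q := by
    have := FreeGroup.isReduced_toWord (x := w')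
    rw [hw', FreeGroup.IsReduced, List.isChain_pair, not_cancel_iff] at this
    exact fun h => this (by rw [h])
  obtain ⟨r, hrt, hrq, -⟩ := exists_letter_ne hS t q q
  obtain ⟨u, hut, huq, hur⟩ := exists_letter_ne hS t q r
  have e₁ := hloc.mixed_difference_eq_zero hS (abs_suffixSum_le hC) (hred t q htq)
    (hred t u hut.symm) (hred r q hrq) (hred r u hur.symm)
  have e₂ := hloc.mixed_difference_eq_zero hS (abs_suffixSum_le hC) (hred t q htq)
    (hred t r hrt.symm) (hred u q huq) (hred u r hur)
  have hpair : ∀ v : FreeGroup S, ∀ a b : S × Bool, v.toWord = [a, letterInv b] → ∀ x y,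
      brooksWindow v (x :: ([] ++ [letterInv y])) =
        (if a = x ∧ b = y then 1 else 0) - (if b = x ∧ a = y then 1 else 0) := by
    intro v a b hv x y
    rw [brooksWindow_of_length_eq (by simp [hv]), FreeGroup.toWord_inv, hv]
    have hinj : ∀ c d : S × Bool, letterInv c = letterInv d ↔ c = d := fun c d =>
      ⟨fun h => by simpa using congrArg letterInv h, fun h => by rw [h]⟩
    have := invRev_cons_append_singleton [] a (letterInv b)
    simp only [List.nil_append, FreeGroup.invRev_empty, letterInv_letterInv] at this
    simp [this, hinj]
  simp only [hpair w' t q hw'] at e₁ e₂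
  rcases hw.lt_or_eq with h | h
  · rw [brooksWindow_of_length_lt (m := []) h (letterInv q) (letterInv u),
      brooksWindow_of_length_lt (m := []) (x := r) h (letterInv q) (letterInv u)] at e₁
    simp [htq, hrt.symm, hrq.symm, hut.symm, huq.symm, htq.symm] at e₁
  · obtain ⟨a, b', hab⟩ := List.length_eq_two.mp h
    obtain ⟨b, rfl⟩ : ∃ b, b' = letterInv b := ⟨letterInv b', by simp⟩
    have hne' : ¬ (a = t ∧ b = q) := fun h =>
      hne (FreeGroup.toWord_injective (by rw [hab, hw', h.1, h.2]))
    have hab' : a ≠ b := by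
      have := FreeGroup.isReduced_toWord (x := w)
      rw [hab, FreeGroup.IsReduced, List.isChain_pair, not_cancel_iff] at this
      exact fun h => this (by rw [h])
    simp only [hpair w a b hab] at e₁ e₂
    grind

lemma unbounded_of_two_lt_length (hS : ∃ a b : S, a ≠ b) {w w' : FreeGroup S} {t s : S × Bool}
    {m : List (S × Bool)} (hm : m ≠ []) (hw' : w'.toWord = t :: (m ++ [s]))
    (hw : w.toWord.length ≤ m.length + 2) (hne : w ≠ w') {C : ℝ} :
    ¬ ∀ γ : FreeGroup S, |Brooks w γ - Brooks w' γ| ≤ C := by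
  intro hC
  have hlen : w'.toWord.length = m.length + 2 := by simp [hw']
  have hloc : IsLocal (m.length + 2) (fun M => brooksWindow w M - brooksWindow w' M) :=
    isLocal_brooksWindow_sub hw hlen.le
  have hred : FreeGroup.IsReduced (t :: (m ++ [s])) := hw' ▸ FreeGroup.isReduced_toWord
  have hmred : FreeGroup.IsReduced m := hred.infix ⟨[t], [s], by simp⟩
  have hSne : Nonempty S := ⟨t.1⟩
  obtain ⟨a, b, hab⟩ := exists_unique_ends hmred hm hSne w
  obtain ⟨a', b', hab'⟩ := exists_unique_ends hmred hm hSne w'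
  obtain ⟨rfl, rfl⟩ := hab' t s (Or.inl hw')
  obtain ⟨t', ht, hta, htm⟩ := exists_letter_ne hS t a (letterInv (m.head hm))
  obtain ⟨s', hs, hsb, hsm⟩ := exists_letter_ne hS s b (letterInv (m.getLast hm))
  have ht₀ : ∀ c ∈ m.head?, t ≠ letterInv c := by
    intro c hc h
    unfold FreeGroup.IsReduced at hred
    rw [List.isChain_cons] at hred
    have := hred.1 c (by rwa [List.head?_append_of_ne_nil _ hm])
    rw [not_cancel_iff] at this
    exact this (letterInv_eq_comm.mp h.symm)
  have hs₀ : ∀ c ∈ m.getLast?, s ≠ letterInv c := by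
    intro c hc
    unfold FreeGroup.IsReduced at hred
    rw [List.isChain_cons, List.isChain_append] at hred
    exact not_cancel_iff.mp (hred.2.2.2 c hc s (by simp))
  have ht₁ : ∀ c ∈ m.head?, t' ≠ letterInv c := by
    intro c hc
    rw [List.head?_eq_some_head hm] at hc
    simpa [← Option.some_inj.mp hc] using htm
  have hs₁ : ∀ c ∈ m.getLast?, s' ≠ letterInv c := by
    intro c hc
    rw [List.getLast?_eq_some_getLast hm] at hc
    simpa [← Option.some_inj.mp hc] using hsm
  have e := hloc.mixed_difference_eq_zero hS (abs_suffixSum_le hC) hred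
    (isReduced_cons_append_singleton hmred ht₀ hs₁ hm)
    (isReduced_cons_append_singleton hmred ht₁ hs₀ hm)
    (isReduced_cons_append_singleton hmred ht₁ hs₁ hm)
  have hzero : ∀ (v : FreeGroup S) (x y : S × Bool), v.toWord.length = m.length + 2 →
      ¬ (v.toWord = x :: (m ++ [y]) ∨ v⁻¹.toWord = x :: (m ++ [y])) →
      brooksWindow v (x :: (m ++ [y])) = 0 := by
    intro v x y hv h
    rw [not_or] at h
    rw [brooksWindow_of_length_eq (by simp [hv]), if_neg h.1, if_neg h.2, sub_zero]
  have hone : brooksWindow w' (t :: (m ++ [s])) = 1 := by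
    have := toWord_ne_toWord_inv (u := w') (by simp [hw'])
    rw [brooksWindow_of_length_eq (by simp [hw']), if_pos hw', if_neg (hw' ▸ this.symm), sub_zero]
  rw [hone, hzero w' t s' hlen fun h => hs (hab' _ _ h).2,
    hzero w' t' s hlen fun h => ht (hab' _ _ h).1,
    hzero w' t' s' hlen fun h => ht (hab' _ _ h).1] at e
  rcases hw.lt_or_eq with h | h
  · rw [brooksWindow_of_length_lt h s s', brooksWindow_of_length_lt (x := t') h s s'] at e
    linarith
  · rw [hzero w t s' h fun h => hsb (hab _ _ h).2, hzero w t' s h fun h => hta (hab _ _ h).1,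
      hzero w t' s' h fun h => hta (hab _ _ h).1, brooksWindow_of_length_eq (by simp [h]),
      if_neg fun h => hne (FreeGroup.toWord_injective (h.trans hw'.symm))] at e
    split_ifs at e <;> norm_num at e

lemma unbounded_of_length_le (hS : ∃ a b : S, a ≠ b) {w w' : FreeGroup S}
    (hlen : w.toWord.length ≤ w'.toWord.length) (hne : w ≠ w') {C : ℝ} :
    ¬ ∀ γ : FreeGroup S, |Brooks w γ - Brooks w' γ| ≤ C := by
  rcases hw' : w'.toWord with _ | ⟨t, l⟩
  · rw [hw', List.length_nil, Nat.le_zero, List.length_eq_zero_iff] at hlen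
    exact absurd (FreeGroup.toWord_injective (hlen.trans hw'.symm)) hne
  rcases List.eq_nil_or_concat l with rfl | ⟨m, s, rfl⟩
  · exact unbounded_of_length_one hw' (by simpa [hw'] using hlen) hne
  rcases eq_or_ne m [] with rfl | hm
  · exact unbounded_of_length_two hS hw' (by simpa [hw'] using hlen) hne
  · exact unbounded_of_two_lt_length hS hm (by simpa using hw') (by simpa [hw'] using hlen) hne

end Windows

/-- Lemma `lem:bounded_distance_brooks`: in a non-abelian free
group (free on a set with at least two elements), two big Brooks quasimorphisms
`H_w`, `H_{w'}` are at bounded distance if and only if `w = w'`. -/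
theorem statement19 {S : Type*} [DecidableEq S] (hS : ∃ a b : S, a ≠ b)
    (w w' : FreeGroup S) :
    (∃ C : ℝ, ∀ γ : FreeGroup S, |Brooks w γ - Brooks w' γ| ≤ C) ↔ w = w' := by
  refine ⟨fun ⟨C, hC⟩ => ?_, fun h => ⟨0, fun γ => by simp [h]⟩⟩
  by_contra hne
  rcases le_total w.toWord.length w'.toWord.length with h | h
  · exact unbounded_of_length_le hS h hne hC
  · exact unbounded_of_length_le hS h (Ne.symm hne) fun γ =>
      (abs_sub_comm (Brooks w' γ) (Brooks w γ)).trans_le (hC γ)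

end MedianQM
end
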